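/- arXiv:2510.02577 — 6 statements merged into one kernel-verified Lean document; each statement's English description precedes it below -/
import Mathlib

section
/- Let α, β, γ ∈ ℝ satisfy γ² − 2βγ − α = 0, and set κ := β − γ (so that κ² = α + β²). Suppose u, η : ℝ × ℝ → ℝ are smooth and solve the dispersive long-wave system ∂_t u = −∂_x(u²/2 + η + β ∂_x u), ∂_t η = −∂_x(uη + α ∂_x²u − β ∂_x η). Then the pair (u, η̃) with η̃ := η + γ ∂_x u solves the 1D BKBK system ∂_t u = −∂_x(u²/2 + η̃ + κ ∂_x u), ∂_t η̃ = −∂_x(u η̃) + κ ∂_x² η̃. -/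
/-- spatial partial derivative of a function of `(x, t)` -/
noncomputable def pdx (f : ℝ → ℝ → ℝ) (x t : ℝ) : ℝ := deriv (fun x' => f x' t) x

/-- temporal partial derivative of a function of `(x, t)` -/
noncomputable def pdt (f : ℝ → ℝ → ℝ) (x t : ℝ) : ℝ := deriv (fun t' => f x t') t

/-- joint smoothness of a function of `(x, t)` -/
def JointlySmooth (f : ℝ → ℝ → ℝ) : Prop :=
  ContDiff ℝ (⊤ : ℕ∞) (fun p : ℝ × ℝ => f p.1 p.2)

namespace JointlySmooth

variable {f g : ℝ → ℝ → ℝ}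

theorem add (hf : JointlySmooth f) (hg : JointlySmooth g) :
    JointlySmooth (fun x t => f x t + g x t) :=
  ContDiff.add hf hg

theorem mul (hf : JointlySmooth f) (hg : JointlySmooth g) :
    JointlySmooth (fun x t => f x t * g x t) :=
  ContDiff.mul hf hg

theorem const_mul (c : ℝ) (hf : JointlySmooth f) : JointlySmooth (fun x t => c * f x t) :=
  ContDiff.mul contDiff_const hf

theorem differentiable (hf : JointlySmooth f) :
    Differentiable ℝ (fun p : ℝ × ℝ => f p.1 p.2) :=
  ContDiff.differentiable hf (by simp)

theorem differentiableAt_left (hf : JointlySmooth f) (x t : ℝ) :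
    DifferentiableAt ℝ (fun x' => f x' t) x :=
  (hf.differentiable (x, t)).comp (f := fun x' : ℝ => (x', t)) x (by fun_prop)

theorem differentiableAt_right (hf : JointlySmooth f) (x t : ℝ) :
    DifferentiableAt ℝ (fun t' => f x t') t :=
  (hf.differentiable (x, t)).comp (f := fun t' : ℝ => (x, t')) t (by fun_prop)

theorem pdx_eq_fderiv (hf : JointlySmooth f) (x t : ℝ) :
    pdx f x t = fderiv ℝ (fun p : ℝ × ℝ => f p.1 p.2) (x, t) (1, 0) :=
  ((hf.differentiable (x, t)).hasFDerivAt.comp_hasDerivAt (f := fun x' : ℝ => (x', t)) x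
    ((hasDerivAt_id x).prodMk (hasDerivAt_const x t))).deriv

theorem pdt_eq_fderiv (hf : JointlySmooth f) (x t : ℝ) :
    pdt f x t = fderiv ℝ (fun p : ℝ × ℝ => f p.1 p.2) (x, t) (0, 1) :=
  ((hf.differentiable (x, t)).hasFDerivAt.comp_hasDerivAt (f := fun t' : ℝ => (x, t')) t
    ((hasDerivAt_const t x).prodMk (hasDerivAt_id t))).deriv

theorem contDiff_fderiv (hf : JointlySmooth f) :
    ContDiff ℝ (⊤ : ℕ∞) (fderiv ℝ (fun p : ℝ × ℝ => f p.1 p.2)) :=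
  ContDiff.fderiv_right hf (by simp)

theorem spatial_deriv (hf : JointlySmooth f) : JointlySmooth (pdx f) := by
  unfold JointlySmooth
  simp only [hf.pdx_eq_fderiv]
  exact hf.contDiff_fderiv.clm_apply contDiff_const

theorem temporal_deriv (hf : JointlySmooth f) : JointlySmooth (pdt f) := by
  unfold JointlySmooth
  simp only [hf.pdt_eq_fderiv]
  exact hf.contDiff_fderiv.clm_apply contDiff_const

theorem pdt_pdx_comm (hf : JointlySmooth f) (x t : ℝ) :
    pdt (pdx f) x t = pdx (pdt f) x t := by
  have hd := (hf.contDiff_fderiv.differentiable (by simp)) (x, t)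
  have hsymm : IsSymmSndFDerivAt ℝ (fun p : ℝ × ℝ => f p.1 p.2) (x, t) :=
    (ContDiff.contDiffAt hf).isSymmSndFDerivAt
      (by simpa using WithTop.coe_le_coe.2 (le_top : (2 : ℕ∞) ≤ ⊤))
  rw [hf.spatial_deriv.pdt_eq_fderiv, hf.temporal_deriv.pdx_eq_fderiv]
  simp only [hf.pdx_eq_fderiv, hf.pdt_eq_fderiv, Prod.mk.eta]
  rw [fderiv_clm_apply hd (differentiableAt_const _),
    fderiv_clm_apply hd (differentiableAt_const _)]
  simpa using hsymm (0, 1) (1, 0)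

theorem pdx_add (hf : JointlySmooth f) (hg : JointlySmooth g) :
    pdx (fun x t => f x t + g x t) = fun x t => pdx f x t + pdx g x t := by
  funext x t
  exact deriv_fun_add (hf.differentiableAt_left x t) (hg.differentiableAt_left x t)

theorem pdt_add (hf : JointlySmooth f) (hg : JointlySmooth g) :
    pdt (fun x t => f x t + g x t) = fun x t => pdt f x t + pdt g x t := by
  funext x t
  exact deriv_fun_add (hf.differentiableAt_right x t) (hg.differentiableAt_right x t)

theorem pdx_mul (hf : JointlySmooth f) (hg : JointlySmooth g) :
    pdx (fun x t => f x t * g x t) =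
      fun x t => pdx f x t * g x t + f x t * pdx g x t := by
  funext x t
  exact deriv_fun_mul (hf.differentiableAt_left x t) (hg.differentiableAt_left x t)

end JointlySmooth

theorem pdx_const_mul (c : ℝ) (f : ℝ → ℝ → ℝ) :
    pdx (fun x t => c * f x t) = fun x t => c * pdx f x t := by
  funext x t
  exact deriv_const_mul_field c

theorem pdt_const_mul (c : ℝ) (f : ℝ → ℝ → ℝ) :
    pdt (fun x t => c * f x t) = fun x t => c * pdt f x t := by
  funext x t
  exact deriv_const_mul_field c

/-- Kupershmidt's change of variables `η̃ := η + γ ∂ₓu` turns a smooth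
solution of the dispersive long-wave system with parameters `α, β` into a solution
of the 1D BKBK system with parameter `κ := β − γ`, provided `γ² − 2βγ − α = 0`. -/
theorem kupershmidt_change_of_variables (α β γ : ℝ) (hγ : γ ^ 2 - 2 * β * γ - α = 0)
    (κ : ℝ) (hκ : κ = β - γ)
    (u η : ℝ → ℝ → ℝ)
    (hu : ContDiff ℝ (⊤ : ℕ∞) (fun p : ℝ × ℝ => u p.1 p.2))
    (hη : ContDiff ℝ (⊤ : ℕ∞) (fun p : ℝ × ℝ => η p.1 p.2))
    (heq1 : ∀ x t, pdt u x t =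
      - pdx (fun x t => u x t ^ 2 / 2 + η x t + β * pdx u x t) x t)
    (heq2 : ∀ x t, pdt η x t =
      - pdx (fun x t => u x t * η x t + α * pdx (pdx u) x t - β * pdx η x t) x t) :
    (∀ x t, pdt u x t =
      - pdx (fun x t => u x t ^ 2 / 2 + (η x t + γ * pdx u x t) + κ * pdx u x t) x t) ∧
    (∀ x t, pdt (fun x t => η x t + γ * pdx u x t) x t =
      - pdx (fun x t => u x t * (η x t + γ * pdx u x t)) x t
        + κ * pdx (pdx (fun x t => η x t + γ * pdx u x t)) x t) := by
  have hu : JointlySmooth u := hu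
  have hη : JointlySmooth η := hη
  have hux := hu.spatial_deriv
  have huxx := hux.spatial_deriv
  have hηx := hη.spatial_deriv
  have hut : pdt u = fun x t => -1 * (u x t * pdx u x t + (pdx η x t + β * pdx (pdx u) x t)) := by
    funext x t
    have e : (fun x t => u x t ^ 2 / 2 + η x t + β * pdx u x t) =
        fun x t => (1 / 2) * (u x t * u x t) + (η x t + β * pdx u x t) := by
      funext x t; ring
    rw [heq1, e, ((hu.mul hu).const_mul _).pdx_add (hη.add (hux.const_mul β)),
      hη.pdx_add (hux.const_mul β), pdx_const_mul, pdx_const_mul, hu.pdx_mul hu]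
    ring
  refine ⟨fun x t => ?_, fun x t => ?_⟩
  · rw [heq1]
    congr 2
    funext x t
    rw [hκ]
    ring
  · have e : (fun x t => u x t * η x t + α * pdx (pdx u) x t - β * pdx η x t) =
        fun x t => u x t * η x t + (α * pdx (pdx u) x t + -β * pdx η x t) := by
      funext x t; ring
    rw [hη.pdt_add (hux.const_mul γ), pdt_const_mul, hη.pdx_add (hux.const_mul γ), pdx_const_mul,
      hηx.pdx_add (huxx.const_mul γ), pdx_const_mul,
      hu.pdx_mul (hη.add (hux.const_mul γ)), hη.pdx_add (hux.const_mul γ), pdx_const_mul]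
    beta_reduce
    rw [hu.pdt_pdx_comm, hut, pdx_const_mul,
      (hu.mul hux).pdx_add (hηx.add (huxx.const_mul β)), hu.pdx_mul hux,
      hηx.pdx_add (huxx.const_mul β), pdx_const_mul,
      heq2, e, (hu.mul hη).pdx_add ((huxx.const_mul α).add (hηx.const_mul (-β))),
      (huxx.const_mul α).pdx_add (hηx.const_mul (-β)), pdx_const_mul, pdx_const_mul,
      hu.pdx_mul hη, hκ]
    linear_combination pdx (pdx (pdx u)) x t * hγ
end

section
/- Let κ > 0 and c, λ, φ ∈ ℝ. Define u(x,t) := c − λκ tanh((λ/2)(x − ct + φ)) and η(x,t) := λ²κ² sech²((λ/2)(x − ct + φ)). Then (u, η) is an exact solution of the 1D BKBK system: ∂_t u = −∂_x(u²/2 + η + κ ∂_x u) and ∂_t η = −∂_x(uη) + κ ∂_x²η hold at every (x,t) ∈ ℝ². -/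
/-- The derivative of `tanh` is `1 - tanh ^ 2`. -/
theorem hasDerivAt_tanh_one_sub_sq (y : ℝ) :
    HasDerivAt Real.tanh (1 - Real.tanh y ^ 2) y := by
  have hc : Real.cosh y ≠ 0 := (Real.cosh_pos y).ne'
  have h := (Real.hasDerivAt_sinh y).div (Real.hasDerivAt_cosh y) hc
  have hfun : Real.tanh = Real.sinh / Real.cosh := by
    funext z
    exact Real.tanh_eq_sinh_div_cosh z
  rw [hfun]
  refine h.congr_deriv ?_
  simp only [Pi.div_apply]
  field_simp

theorem one_div_cosh_sq_eq (y : ℝ) : (1 / Real.cosh y) ^ 2 = 1 - Real.tanh y ^ 2 := by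
  have hc : Real.cosh y ≠ 0 := (Real.cosh_pos y).ne'
  rw [Real.tanh_eq_sinh_div_cosh]
  field_simp
  linarith [Real.cosh_sq y]

/-- For `κ > 0`, the travelling wave
`u = c − λκ tanh((λ/2)(x − ct + φ))`, `η = λ²κ² sech²((λ/2)(x − ct + φ))`
is an exact solution of the 1D BKBK system
`∂ₜu = −∂ₓ(u²/2 + η + κ∂ₓu)`, `∂ₜη = −∂ₓ(uη) + κ∂ₓ²η`. -/
theorem bkbk_travelling_wave (κ : ℝ) (hκ : 0 < κ) (c lam φ : ℝ)
    (u η : ℝ → ℝ → ℝ)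
    (hu : u = fun x t => c - lam * κ * Real.tanh ((lam / 2) * (x - c * t + φ)))
    (hη : η = fun x t =>
      lam ^ 2 * κ ^ 2 * (1 / Real.cosh ((lam / 2) * (x - c * t + φ))) ^ 2) :
    (∀ x t, pdt u x t =
      - pdx (fun x t => u x t ^ 2 / 2 + η x t + κ * pdx u x t) x t) ∧
    (∀ x t, pdt η x t =
      - pdx (fun x t => u x t * η x t) x t + κ * pdx (pdx η) x t) := by
  have hη' : η = fun x t =>
      lam ^ 2 * κ ^ 2 * (1 - Real.tanh ((lam / 2) * (x - c * t + φ)) ^ 2) := by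
    simp only [hη, one_div_cosh_sq_eq]
  clear hη
  set T : ℝ → ℝ → ℝ := fun x t => Real.tanh ((lam / 2) * (x - c * t + φ)) with hT
  have hTx (x t : ℝ) : HasDerivAt (fun y => T y t) ((1 - T x t ^ 2) * (lam / 2)) x := by
    have h : HasDerivAt (fun y => (lam / 2) * (y - c * t + φ)) (lam / 2) x := by
      simpa using (((hasDerivAt_id x).sub_const (c * t)).add_const φ).const_mul (lam / 2)
    exact (hasDerivAt_tanh_one_sub_sq _).comp x h
  have hTt (x t : ℝ) :
      HasDerivAt (fun s => T x s) ((1 - T x t ^ 2) * (lam / 2 * -c)) t := by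
    have h : HasDerivAt (fun s => (lam / 2) * (x - c * s + φ)) (lam / 2 * -c) t := by
      simpa using
        ((((hasDerivAt_id t).const_mul c).const_sub x).add_const φ).const_mul (lam / 2)
    exact (hasDerivAt_tanh_one_sub_sq _).comp t h
  have hu' : u = fun x t => c - lam * κ * T x t := hu
  have hη'' : η = fun x t => lam ^ 2 * κ ^ 2 * (1 - T x t ^ 2) := hη'
  clear hu hη'
  clear_value T
  subst hu' hη''
  have hux (x t : ℝ) : HasDerivAt (fun y => c - lam * κ * T y t)
      (-(lam * κ * ((1 - T x t ^ 2) * (lam / 2)))) x :=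
    ((hTx x t).const_mul (lam * κ)).const_sub c
  have hηx (x t : ℝ) : HasDerivAt (fun y => lam ^ 2 * κ ^ 2 * (1 - T y t ^ 2))
      (-(lam ^ 3 * κ ^ 2 * (T x t * (1 - T x t ^ 2)))) x := by
    refine ((((hTx x t).pow 2).const_sub 1).const_mul (lam ^ 2 * κ ^ 2)).congr_deriv ?_
    norm_num
    ring
  have hpux : pdx (fun x t => c - lam * κ * T x t) =
      fun x t => -(lam * κ * ((1 - T x t ^ 2) * (lam / 2))) := by
    funext x t
    exact (hux x t).deriv
  have hpηx : pdx (fun x t => lam ^ 2 * κ ^ 2 * (1 - T x t ^ 2)) =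
      fun x t => -(lam ^ 3 * κ ^ 2 * (T x t * (1 - T x t ^ 2))) := by
    funext x t
    exact (hηx x t).deriv
  have hsq (x t : ℝ) : HasDerivAt (fun y => 1 - T y t ^ 2)
      (-(lam * (T x t * (1 - T x t ^ 2)))) x := by
    refine (((hTx x t).pow 2).const_sub 1).congr_deriv ?_
    norm_num
    ring
  rw [hpux, hpηx]
  refine ⟨fun x t => ?_, fun x t => ?_⟩
  · have h₁ := ((hTt x t).const_mul (lam * κ)).const_sub c
    have h₂ := ((((hux x t).pow 2).div_const 2).add (hηx x t)).add
      ((((hsq x t).mul_const (lam / 2)).const_mul (lam * κ)).neg.const_mul κ)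
    refine h₁.deriv.trans (Eq.trans ?_ (congrArg Neg.neg h₂.deriv.symm))
    norm_num
    ring
  · have h₁ := (((hTt x t).pow 2).const_sub 1).const_mul (lam ^ 2 * κ ^ 2)
    have h₂ := (hux x t).mul (hηx x t)
    have h₃ := (((hTx x t).mul (hsq x t)).const_mul (lam ^ 3 * κ ^ 2)).neg
    refine h₁.deriv.trans (Eq.trans ?_
      (congrArg₂ (fun a b => -a + κ * b) h₂.deriv.symm h₃.deriv.symm))
    norm_num
    ring
end

section
/- Let κ ∈ ℝ, κ ≠ 0, and let ν > 2|κ|³/(3√3). Then for every real k ≠ 0 and every ω ∈ ℂ satisfying (ω + iνk⁴)² = k²(1 − κ²k²), one has Im ω < 0. -/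
/-- A dissipation above the critical value `2|κ|³/(3√3)` dominates the growth rate. -/
theorem sub_one_lt_of_critical_dissipation_lt {κ ν s : ℝ}
    (hν : 2 * |κ| ^ 3 / (3 * Real.sqrt 3) < ν) (hs : 0 < s) :
    κ ^ 2 * s - 1 < ν ^ 2 * s ^ 3 := by
  have hν2 : 4 * κ ^ 6 / 27 < ν ^ 2 := by
    have h := pow_lt_pow_left₀ hν (by positivity) two_ne_zero
    have h6 : |κ| ^ 6 = κ ^ 6 := Even.pow_abs (by decide) κ
    calc 4 * κ ^ 6 / 27 = (2 * |κ| ^ 3 / (3 * Real.sqrt 3)) ^ 2 := by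
          rw [div_pow, mul_pow, mul_pow, Real.sq_sqrt (by norm_num), ← pow_mul, h6]
          ring
      _ < ν ^ 2 := h
  have hlt := mul_lt_mul_of_pos_right hν2 (pow_pos hs 3)
  have hnonneg : 0 ≤ (2 * (κ ^ 2 * s) - 3) ^ 2 * (κ ^ 2 * s + 3) := by positivity
  linarith


/-- If `κ ≠ 0` and `ν > 2|κ|³/(3√3)`, then every root `ω` of the
regularized BKBK dispersion relation `(ω + iνk⁴)² = k²(1 − κ²k²)` with `k ≠ 0`
has strictly negative imaginary part: the fourth-order dissipation eliminates
all unstable modes. -/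
theorem bkbk_regularized_stability (κ ν : ℝ) (hκ : κ ≠ 0)
    (hν : 2 * |κ| ^ 3 / (3 * Real.sqrt 3) < ν) :
    ∀ k : ℝ, k ≠ 0 → ∀ ω : ℂ,
      (ω + Complex.I * (ν : ℂ) * (k : ℂ) ^ 4) ^ 2
        = (k : ℂ) ^ 2 * (1 - (κ : ℂ) ^ 2 * (k : ℂ) ^ 2) →
      ω.im < 0 := by
  intro k hk ω h
  have hν0 : 0 < ν := lt_of_le_of_lt (by positivity) hν
  have hk2 : 0 < k ^ 2 := by positivity
  have hdamp : 0 < ν * k ^ 4 := by positivity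
  have hshift : ω + Complex.I * (ν : ℂ) * (k : ℂ) ^ 4 = ⟨ω.re, ω.im + ν * k ^ 4⟩ := by
    apply Complex.ext <;> simp [← Complex.ofReal_pow]
  have hrhs : (k : ℂ) ^ 2 * (1 - (κ : ℂ) ^ 2 * (k : ℂ) ^ 2)
      = ((k ^ 2 * (1 - κ ^ 2 * k ^ 2) : ℝ) : ℂ) := by push_cast; ring
  rw [hshift, hrhs, sq] at h
  have hre := congrArg Complex.re h
  have him := congrArg Complex.im h
  simp only [Complex.mul_re, Complex.mul_im, Complex.ofReal_re, Complex.ofReal_im] at hre him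
  by_contra! hω
  have hre0 : ω.re = 0 := by
    have hprod : ω.re * (ω.im + ν * k ^ 4) = 0 := by linarith
    exact (mul_eq_zero.mp hprod).resolve_right (by positivity)
  rw [hre0] at hre
  have hgrowth := mul_lt_mul_of_pos_left (sub_one_lt_of_critical_dissipation_lt hν hk2) hk2
  have hsq : (ν * k ^ 4) ^ 2 ≤ (ω.im + ν * k ^ 4) ^ 2 :=
    pow_le_pow_left₀ hdamp.le (by linarith) 2
  linarith
end

section
/- Let κ ∈ ℝ and let u, η : ℝ × ℝ → ℝ be smooth with η > 0 everywhere, solving the 1D BKBK system ∂_t u = −∂_x(u²/2 + η + κ ∂_x u), ∂_t η = −∂_x(uη) + κ ∂_x²η. Then the modified transport velocity v := u − κ ∂_x(ln η) = u − κ η_x/η satisfies ∂_t v = −∂_x( v²/2 − (κ²/2)(η_x/η)² + κ² η_xx/η + η ) and ∂_t η = −∂_x(η v) at every point. -/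
section PartialDerivatives

variable {f : ℝ → ℝ → ℝ}

theorem hasDerivAt_pdx (hf : ContDiff ℝ (⊤ : ℕ∞) (fun p : ℝ × ℝ => f p.1 p.2)) (x t : ℝ) :
    HasDerivAt (fun x' => f x' t) (pdx f x t) x := by
  have h : Differentiable ℝ (fun x' : ℝ => f x' t) :=
    (hf.differentiable (by simp)).comp (f := fun x' : ℝ => (x', t)) (by fun_prop)
  exact (h x).hasDerivAt

theorem hasDerivAt_pdt (hf : ContDiff ℝ (⊤ : ℕ∞) (fun p : ℝ × ℝ => f p.1 p.2)) (x t : ℝ) :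
    HasDerivAt (fun t' => f x t') (pdt f x t) t := by
  have h : Differentiable ℝ (fun t' : ℝ => f x t') :=
    (hf.differentiable (by simp)).comp (f := fun t' : ℝ => (x, t')) (by fun_prop)
  exact (h t).hasDerivAt

theorem pdx_eq_fderiv {x t : ℝ}
    (hf : DifferentiableAt ℝ (fun p : ℝ × ℝ => f p.1 p.2) (x, t)) :
    pdx f x t = fderiv ℝ (fun p : ℝ × ℝ => f p.1 p.2) (x, t) (1, 0) :=
  (hf.hasFDerivAt.comp_hasDerivAt (f := fun x' : ℝ => (x', t)) x
    ((hasDerivAt_id x).prodMk (hasDerivAt_const x t))).deriv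

theorem pdt_eq_fderiv {x t : ℝ}
    (hf : DifferentiableAt ℝ (fun p : ℝ × ℝ => f p.1 p.2) (x, t)) :
    pdt f x t = fderiv ℝ (fun p : ℝ × ℝ => f p.1 p.2) (x, t) (0, 1) :=
  (hf.hasFDerivAt.comp_hasDerivAt (f := fun t' : ℝ => (x, t')) t
    ((hasDerivAt_const t x).prodMk (hasDerivAt_id t))).deriv

theorem contDiff_pdx (hf : ContDiff ℝ (⊤ : ℕ∞) (fun p : ℝ × ℝ => f p.1 p.2)) :
    ContDiff ℝ (⊤ : ℕ∞) (fun p : ℝ × ℝ => pdx f p.1 p.2) := by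
  simp_rw [fun p : ℝ × ℝ => pdx_eq_fderiv (hf.differentiable (by simp) (p.1, p.2))]
  exact (hf.fderiv_right (by simp)).clm_apply contDiff_const

theorem contDiff_pdt (hf : ContDiff ℝ (⊤ : ℕ∞) (fun p : ℝ × ℝ => f p.1 p.2)) :
    ContDiff ℝ (⊤ : ℕ∞) (fun p : ℝ × ℝ => pdt f p.1 p.2) := by
  simp_rw [fun p : ℝ × ℝ => pdt_eq_fderiv (hf.differentiable (by simp) (p.1, p.2))]
  exact (hf.fderiv_right (by simp)).clm_apply contDiff_const

theorem pdt_pdx_comm (hf : ContDiff ℝ (⊤ : ℕ∞) (fun p : ℝ × ℝ => f p.1 p.2)) (x t : ℝ) :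
    pdt (pdx f) x t = pdx (pdt f) x t := by
  have hd : DifferentiableAt ℝ (fderiv ℝ (fun p : ℝ × ℝ => f p.1 p.2)) (x, t) :=
    (hf.fderiv_right (m := (⊤ : ℕ∞)) (by simp)).differentiable (by simp) (x, t)
  have hsymm : IsSymmSndFDerivAt ℝ (fun p : ℝ × ℝ => f p.1 p.2) (x, t) :=
    hf.contDiffAt.isSymmSndFDerivAt (by
      rw [minSmoothness_of_isRCLikeNormedField]
      exact WithTop.coe_le_coe.2 (le_top : (2 : ℕ∞) ≤ ⊤))
  rw [pdt_eq_fderiv ((contDiff_pdx hf).differentiable (by simp) (x, t)),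
    pdx_eq_fderiv ((contDiff_pdt hf).differentiable (by simp) (x, t))]
  simp_rw [fun p : ℝ × ℝ => pdx_eq_fderiv (hf.differentiable (by simp) (p.1, p.2)),
    fun p : ℝ × ℝ => pdt_eq_fderiv (hf.differentiable (by simp) (p.1, p.2))]
  rw [fderiv_clm_apply hd (differentiableAt_const _),
    fderiv_clm_apply hd (differentiableAt_const _)]
  simpa using hsymm (0, 1) (1, 0)

end PartialDerivatives

/-- For smooth solutions `(u, η)` of the 1D BKBK system with `η > 0`,
the modified transport velocity `v := u − κ ∂ₓ ln η` satisfies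
`∂ₜv = −∂ₓ(v²/2 − (κ²/2)(ηₓ/η)² + κ² ηₓₓ/η + η)` and `∂ₜη = −∂ₓ(ηv)`. -/
theorem bkbk_1d_v_eta_form (κ : ℝ) (u η : ℝ → ℝ → ℝ)
    (hu : ContDiff ℝ (⊤ : ℕ∞) (fun p : ℝ × ℝ => u p.1 p.2))
    (hη : ContDiff ℝ (⊤ : ℕ∞) (fun p : ℝ × ℝ => η p.1 p.2))
    (hηpos : ∀ x t, 0 < η x t)
    (heq1 : ∀ x t, pdt u x t =
      - pdx (fun x t => u x t ^ 2 / 2 + η x t + κ * pdx u x t) x t)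
    (heq2 : ∀ x t, pdt η x t =
      - pdx (fun x t => u x t * η x t) x t + κ * pdx (pdx η) x t)
    (v : ℝ → ℝ → ℝ)
    (hv : v = fun x t => u x t - κ * pdx (fun x t => Real.log (η x t)) x t) :
    (∀ x t, pdt v x t =
      - pdx (fun x t => v x t ^ 2 / 2 - (κ ^ 2 / 2) * (pdx η x t / η x t) ^ 2
          + κ ^ 2 * pdx (pdx η) x t / η x t + η x t) x t) ∧
    (∀ x t, pdt η x t = - pdx (fun x t => η x t * v x t) x t) := by
  have hηne : ∀ x t, η x t ≠ 0 := fun x t => (hηpos x t).ne'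
  have hlog : ContDiff ℝ (⊤ : ℕ∞) (fun p : ℝ × ℝ => Real.log (η p.1 p.2)) :=
    hη.log fun p => hηne p.1 p.2
  have hlogx : pdx (fun x t => Real.log (η x t)) = fun x t => pdx η x t / η x t := by
    funext x t
    exact ((hasDerivAt_pdx hη x t).log (hηne x t)).deriv
  have hlogt : pdt (fun x t => Real.log (η x t)) = fun x t => pdt η x t / η x t := by
    funext x t
    exact ((hasDerivAt_pdt hη x t).log (hηne x t)).deriv
  have hηt : ∀ x t, pdt η x t =
      -(pdx u x t * η x t + u x t * pdx η x t) + κ * pdx (pdx η) x t := fun x t => by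
    rw [heq2 x t]
    congr 2
    exact ((hasDerivAt_pdx hu x t).mul (hasDerivAt_pdx hη x t)).deriv
  constructor
  · intro x t
    have hvt : pdt v x t = pdt u x t - κ * pdx (pdt fun x t => Real.log (η x t)) x t := by
      rw [← pdt_pdx_comm hlog, hv]
      exact ((hasDerivAt_pdt hu x t).sub
        ((hasDerivAt_pdt (contDiff_pdx hlog) x t).const_mul κ)).deriv
    have hflux : (fun x t => v x t ^ 2 / 2 - (κ ^ 2 / 2) * (pdx η x t / η x t) ^ 2
          + κ ^ 2 * pdx (pdx η) x t / η x t + η x t) =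
        fun x t => (u x t ^ 2 / 2 + η x t + κ * pdx u x t) +
          κ * pdt (fun x t => Real.log (η x t)) x t := by
      funext x t
      have hne := hηne x t
      simp only [hv, hlogx, hlogt, hηt]
      field_simp
      ring
    have hG : ContDiff ℝ (⊤ : ℕ∞)
        (fun p : ℝ × ℝ => u p.1 p.2 ^ 2 / 2 + η p.1 p.2 + κ * pdx u p.1 p.2) :=
      (((hu.pow 2).div_const 2).add hη).add (contDiff_const.mul (contDiff_pdx hu))
    have hsum : pdx (fun x t => (u x t ^ 2 / 2 + η x t + κ * pdx u x t) +
          κ * pdt (fun x t => Real.log (η x t)) x t) x t =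
        pdx (fun x t => u x t ^ 2 / 2 + η x t + κ * pdx u x t) x t +
          κ * pdx (pdt fun x t => Real.log (η x t)) x t :=
      ((hasDerivAt_pdx (f := fun x t => u x t ^ 2 / 2 + η x t + κ * pdx u x t) hG x t).add
        ((hasDerivAt_pdx (contDiff_pdt hlog) x t).const_mul κ)).deriv
    rw [hvt, hflux, hsum, heq1 x t]
    ring
  · intro x t
    have hmul : (fun x t => η x t * v x t) = fun x t => u x t * η x t - κ * pdx η x t := by
      funext x t
      have hne := hηne x t
      simp only [hv, hlogx]
      field_simp
    have hdiff : pdx (fun x t => u x t * η x t - κ * pdx η x t) x t =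
        (pdx u x t * η x t + u x t * pdx η x t) - κ * pdx (pdx η) x t :=
      (((hasDerivAt_pdx hu x t).mul (hasDerivAt_pdx hη x t)).sub
        ((hasDerivAt_pdx (contDiff_pdx hη) x t).const_mul κ)).deriv
    rw [hmul, hdiff, hηt x t]
    ring
end

section
/- Let κ ∈ ℝ and let u, η : ℝ × ℝ → ℝ be smooth with η > 0 everywhere, solving the 1D BKBK system ∂_t u = −∂_x(u²/2 + η + κ ∂_x u), ∂_t η = −∂_x(uη) + κ ∂_x²η. Define m := η u, v := u − κ ∂_x(ln η), and 𝓑 := −u²/2 + (κ/η) ∂_x(η u) + η. Then ∂_t m + ∂_x(m v) + m ∂_x v + η ∂_x 𝓑 = 0 and ∂_t η + ∂_x(v η) = 0 hold at every point. -/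
/-- A `C²` function of one real variable is differentiable, with differentiable derivative. -/
theorem ContDiff.hasDerivAt_and_hasDerivAt_deriv {f : ℝ → ℝ} (hf : ContDiff ℝ 2 f) (x : ℝ) :
    HasDerivAt f (deriv f x) x ∧ HasDerivAt (deriv f) (deriv (deriv f) x) x :=
  ⟨(hf.differentiable (by norm_num) x).hasDerivAt,
    ((contDiff_succ_iff_deriv (n := 1)).1 hf |>.2.2.differentiable (by norm_num) x).hasDerivAt⟩

/-- For smooth solutions `(u, η)` of the 1D BKBK system with `η > 0`,
the momentum density `m := ηu`, modified velocity `v := u − κ∂ₓ ln η`, and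
`𝓑 := −u²/2 + (κ/η)∂ₓ(ηu) + η` satisfy the semidirect-product Lie–Poisson form
`∂ₜm + ∂ₓ(mv) + m∂ₓv + η∂ₓ𝓑 = 0` and `∂ₜη + ∂ₓ(vη) = 0`. -/
theorem bkbk_1d_lie_poisson_form (κ : ℝ) (u η : ℝ → ℝ → ℝ)
    (hu : ContDiff ℝ (⊤ : ℕ∞) (fun p : ℝ × ℝ => u p.1 p.2))
    (hη : ContDiff ℝ (⊤ : ℕ∞) (fun p : ℝ × ℝ => η p.1 p.2))
    (hηpos : ∀ x t, 0 < η x t)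
    (heq1 : ∀ x t, pdt u x t =
      - pdx (fun x t => u x t ^ 2 / 2 + η x t + κ * pdx u x t) x t)
    (heq2 : ∀ x t, pdt η x t =
      - pdx (fun x t => u x t * η x t) x t + κ * pdx (pdx η) x t)
    (m v B : ℝ → ℝ → ℝ)
    (hm : m = fun x t => η x t * u x t)
    (hv : v = fun x t => u x t - κ * pdx (fun x t => Real.log (η x t)) x t)
    (hB : B = fun x t => -(u x t ^ 2) / 2
        + (κ / η x t) * pdx (fun x t => η x t * u x t) x t + η x t) :
    (∀ x t, pdt m x t + pdx (fun x t => m x t * v x t) x t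
        + m x t * pdx v x t + η x t * pdx B x t = 0) ∧
    (∀ x t, pdt η x t + pdx (fun x t => v x t * η x t) x t = 0) := by
  have slice_x (f : ℝ → ℝ → ℝ) (hf : ContDiff ℝ (⊤ : ℕ∞) (fun p : ℝ × ℝ => f p.1 p.2)) (x t : ℝ) :
      HasDerivAt (fun y => f y t) (pdx f x t) x ∧
        HasDerivAt (fun y => pdx f y t) (pdx (pdx f) x t) x :=
    ContDiff.hasDerivAt_and_hasDerivAt_deriv (f := fun y => f y t)
      (contDiff_infty.1 (hf.comp (contDiff_id.prodMk contDiff_const)) 2) x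
  have slice_t (f : ℝ → ℝ → ℝ) (hf : ContDiff ℝ (⊤ : ℕ∞) (fun p : ℝ × ℝ => f p.1 p.2)) (x t : ℝ) :
      HasDerivAt (fun s => f x s) (pdt f x t) t :=
    (ContDiff.hasDerivAt_and_hasDerivAt_deriv (f := fun s => f x s)
      (contDiff_infty.1 (hf.comp (contDiff_const.prodMk contDiff_id)) 2) t).1
  have hη0 (x t) : η x t ≠ 0 := (hηpos x t).ne'
  have hlog : ∀ x t, pdx (fun x t => Real.log (η x t)) x t = pdx η x t / η x t :=
    fun x t => ((slice_x η hη x t).1.log (hη0 x t)).deriv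
  have hηu : ∀ x t, pdx (fun x t => η x t * u x t) x t = pdx η x t * u x t + η x t * pdx u x t :=
    fun x t => ((slice_x η hη x t).1.mul (slice_x u hu x t).1).deriv
  have huη : ∀ x t, pdx (fun x t => u x t * η x t) x t = pdx u x t * η x t + u x t * pdx η x t :=
    fun x t => ((slice_x u hu x t).1.mul (slice_x η hη x t).1).deriv
  simp only [hlog] at hv
  simp only [hηu] at hB
  simp only [huη] at heq2
  subst hm hv hB
  have hv' (x t) := (slice_x u hu x t).1.sub
    (((slice_x η hη x t).2.div (slice_x η hη x t).1 (hη0 x t)).const_mul κ)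
  constructor
  · intro x t
    obtain ⟨hu1, hu2⟩ := slice_x u hu x t
    obtain ⟨hη1, hη2⟩ := slice_x η hη x t
    have h0 := hη0 x t
    have hm_t : pdt (fun x t => η x t * u x t) x t = pdt η x t * u x t + η x t * pdt u x t :=
      ((slice_t η hη x t).mul (slice_t u hu x t)).deriv
    have hflux : pdx (fun x t => u x t ^ 2 / 2 + η x t + κ * pdx u x t) x t = _ :=
      ((((hu1.pow 2).div_const 2).add hη1).add (hu2.const_mul κ)).deriv
    have hv_x : pdx (fun x t => u x t - κ * (pdx η x t / η x t)) x t = _ := (hv' x t).deriv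
    have hmv : pdx (fun x t => η x t * u x t * (u x t - κ * (pdx η x t / η x t))) x t = _ :=
      ((hη1.mul hu1).mul (hv' x t)).deriv
    have hB_x : pdx (fun x t => -(u x t ^ 2) / 2
        + (κ / η x t) * (pdx η x t * u x t + η x t * pdx u x t) + η x t) x t = _ :=
      ((((hu1.pow 2).neg.div_const 2).add
        (((hasDerivAt_const x κ).div hη1 h0).mul ((hη2.mul hu1).add (hη1.mul hu2)))).add hη1).deriv
    rw [hm_t, hmv, hv_x, hB_x, heq1, heq2, hflux]
    simp only [Pi.mul_apply, Pi.add_apply, Pi.sub_apply, Pi.div_apply]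
    push_cast
    field_simp
    ring
  · intro x t
    have h0 := hη0 x t
    have hvη : pdx (fun x t => (u x t - κ * (pdx η x t / η x t)) * η x t) x t = _ :=
      ((hv' x t).mul (slice_x η hη x t).1).deriv
    rw [hvη, heq2]
    simp only [Pi.sub_apply, Pi.div_apply]
    field_simp
    ring
end

section
/- Let κ ∈ ℝ, let Φ : ℝ → ℝ be twice continuously differentiable, and let u = (u₁,u₂) : ℝ² → ℝ² and η : ℝ² → ℝ be smooth time-independent fields with η > 0. Define q := (∂₁u₂ − ∂₂u₁)/η, v := u − κ∇ln η, and suppose the critical-point conditions hold: (i) η v = ẑ × ∇(Φ'(q)), i.e. η v₁ = −∂₂(Φ'∘q) and η v₂ = ∂₁(Φ'∘q); and (ii) ½|u|² + κ div u + η + Φ(q) − q Φ'(q) = 0 everywhere. Then (u, η) is an equilibrium solution of the 2D BKBK system: (v·∇)u + Σ_{j=1,2} u_j ∇v_j = ∇𝓑 and div(η v) = 0, where 𝓑 := |u|²/2 − (κ/η) div(η u) − η. -/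
/-- partial derivative in the first variable of a function of `(x, y)` -/
noncomputable def pd1 (f : ℝ → ℝ → ℝ) (x y : ℝ) : ℝ := deriv (fun x' => f x' y) x

/-- partial derivative in the second variable of a function of `(x, y)` -/
noncomputable def pd2 (f : ℝ → ℝ → ℝ) (x y : ℝ) : ℝ := deriv (fun y' => f x y') y

open scoped ContDiff

/-- The horizontal slice of a differentiable function has derivative `pd1`. -/
lemma hasDerivAt_pd1 {f : ℝ → ℝ → ℝ} (hf : Differentiable ℝ (fun p : ℝ × ℝ => f p.1 p.2))
    (x y : ℝ) : HasDerivAt (fun x' => f x' y) (pd1 f x y) x :=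
  ((hf (x, y)).comp (f := fun x' : ℝ => (x', y)) x (by fun_prop)).hasDerivAt

/-- The vertical slice of a differentiable function has derivative `pd2`. -/
lemma hasDerivAt_pd2 {f : ℝ → ℝ → ℝ} (hf : Differentiable ℝ (fun p : ℝ × ℝ => f p.1 p.2))
    (x y : ℝ) : HasDerivAt (fun y' => f x y') (pd2 f x y) y :=
  ((hf (x, y)).comp (f := fun y' : ℝ => (x, y')) y (by fun_prop)).hasDerivAt

lemma fderiv_apply_one_zero {f : ℝ → ℝ → ℝ}
    (hf : Differentiable ℝ (fun p : ℝ × ℝ => f p.1 p.2)) (p : ℝ × ℝ) :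
    fderiv ℝ (fun p : ℝ × ℝ => f p.1 p.2) p (1, 0) = pd1 f p.1 p.2 :=
  ((hf p).hasFDerivAt.comp_hasDerivAt (f := fun x' => (x', p.2)) p.1
    ((hasDerivAt_id p.1).prodMk (hasDerivAt_const p.1 p.2))).unique (hasDerivAt_pd1 hf p.1 p.2)

lemma fderiv_apply_zero_one {f : ℝ → ℝ → ℝ}
    (hf : Differentiable ℝ (fun p : ℝ × ℝ => f p.1 p.2)) (p : ℝ × ℝ) :
    fderiv ℝ (fun p : ℝ × ℝ => f p.1 p.2) p (0, 1) = pd2 f p.1 p.2 :=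
  ((hf p).hasFDerivAt.comp_hasDerivAt (f := fun y' => (p.1, y')) p.2
    ((hasDerivAt_const p.2 p.1).prodMk (hasDerivAt_id p.2))).unique (hasDerivAt_pd2 hf p.1 p.2)

lemma contDiff_pd1 {f : ℝ → ℝ → ℝ} (hf : ContDiff ℝ ∞ (fun p : ℝ × ℝ => f p.1 p.2)) :
    ContDiff ℝ ∞ (fun p : ℝ × ℝ => pd1 f p.1 p.2) := by
  simp only [← fderiv_apply_one_zero (hf.differentiable (by simp))]
  exact (hf.fderiv_right (m := ∞) le_rfl).clm_apply contDiff_const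

lemma contDiff_pd2 {f : ℝ → ℝ → ℝ} (hf : ContDiff ℝ ∞ (fun p : ℝ × ℝ => f p.1 p.2)) :
    ContDiff ℝ ∞ (fun p : ℝ × ℝ => pd2 f p.1 p.2) := by
  simp only [← fderiv_apply_zero_one (hf.differentiable (by simp))]
  exact (hf.fderiv_right (m := ∞) le_rfl).clm_apply contDiff_const

/-- Mixed partial derivatives commute for a differentiable function whose two partial derivatives
are differentiable. -/
lemma pd1_pd2_comm {f : ℝ → ℝ → ℝ} (hf : Differentiable ℝ (fun p : ℝ × ℝ => f p.1 p.2))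
    (h1 : Differentiable ℝ (fun p : ℝ × ℝ => pd1 f p.1 p.2))
    (h2 : Differentiable ℝ (fun p : ℝ × ℝ => pd2 f p.1 p.2)) (x y : ℝ) :
    pd1 (pd2 f) x y = pd2 (pd1 f) x y := by
  have hF : ∀ p : ℝ × ℝ, HasFDerivAt (fun p : ℝ × ℝ => f p.1 p.2)
      (pd1 f p.1 p.2 • ContinuousLinearMap.fst ℝ ℝ ℝ
        + pd2 f p.1 p.2 • ContinuousLinearMap.snd ℝ ℝ ℝ) p := by
    intro p
    convert (hf p).hasFDerivAt using 1
    ext <;> simp [fderiv_apply_one_zero hf, fderiv_apply_zero_one hf]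
  have hF2 := ((h1 (x, y)).hasFDerivAt.smul_const (ContinuousLinearMap.fst ℝ ℝ ℝ)).add
    ((h2 (x, y)).hasFDerivAt.smul_const (ContinuousLinearMap.snd ℝ ℝ ℝ))
  have hs := second_derivative_symmetric hF hF2 (1, 0) (0, 1)
  simpa [fderiv_apply_one_zero h2, fderiv_apply_zero_one h1] using hs

/-- The derivative of `Φ(q) - q Φ'(q)` along a curve is `-q (Φ' ∘ q)'`. -/
lemma hasDerivAt_sub_mul_deriv_comp {Φ q : ℝ → ℝ} {t q' : ℝ} (hΦ : ContDiff ℝ 2 Φ)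
    (hq : HasDerivAt q q' t) :
    HasDerivAt (fun s => Φ (q s) - q s * deriv Φ (q s))
      (-(q t * deriv (fun s => deriv Φ (q s)) t)) t := by
  have hΦ' : ContDiff ℝ 1 (deriv Φ) := ((contDiff_succ_iff_deriv (n := 1)).1 hΦ).2.2
  have hd : HasDerivAt (fun s => deriv Φ (q s)) (deriv (fun s => deriv Φ (q s)) t) t :=
    ((hΦ'.differentiable one_ne_zero _).comp t hq.differentiableAt).hasDerivAt
  have h0 : HasDerivAt (fun s => Φ (q s)) (deriv Φ (q t) * q') t :=
    (hΦ.differentiable two_ne_zero _).hasDerivAt.comp t hq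
  exact (h0.sub (hq.mul hd)).congr_deriv (by ring)

/-- Critical points of the energy–Casimir functional of the 2D BKBK
system are equilibrium solutions: if the time-independent fields `(u, η)` with `η > 0`
satisfy `ηv = ẑ × ∇(Φ'(q))` and `½|u|² + κ div u + η + Φ(q) − qΦ'(q) = 0`, where
`q = (∂₁u₂ − ∂₂u₁)/η` and `v = u − κ∇ln η`, then
`(v·∇)u + Σⱼ uⱼ∇vⱼ = ∇𝓑` and `div(ηv) = 0` with
`𝓑 = |u|²/2 − (κ/η)div(ηu) − η`. -/
theorem bkbk_2d_energy_casimir_equilibria (κ : ℝ) (Φ : ℝ → ℝ) (hΦ : ContDiff ℝ 2 Φ)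
    (u1 u2 η : ℝ → ℝ → ℝ)
    (hu1 : ContDiff ℝ (⊤ : ℕ∞) (fun p : ℝ × ℝ => u1 p.1 p.2))
    (hu2 : ContDiff ℝ (⊤ : ℕ∞) (fun p : ℝ × ℝ => u2 p.1 p.2))
    (hη : ContDiff ℝ (⊤ : ℕ∞) (fun p : ℝ × ℝ => η p.1 p.2))
    (hηpos : ∀ x y, 0 < η x y)
    (q v1 v2 B : ℝ → ℝ → ℝ)
    (hq : q = fun x y => (pd1 u2 x y - pd2 u1 x y) / η x y)
    (hv1 : v1 = fun x y => u1 x y - κ * pd1 (fun x y => Real.log (η x y)) x y)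
    (hv2 : v2 = fun x y => u2 x y - κ * pd2 (fun x y => Real.log (η x y)) x y)
    (hB : B = fun x y => (u1 x y ^ 2 + u2 x y ^ 2) / 2
        - (κ / η x y) * (pd1 (fun x y => η x y * u1 x y) x y
            + pd2 (fun x y => η x y * u2 x y) x y)
        - η x y)
    (hcrit1a : ∀ x y, η x y * v1 x y = - pd2 (fun x y => deriv Φ (q x y)) x y)
    (hcrit1b : ∀ x y, η x y * v2 x y = pd1 (fun x y => deriv Φ (q x y)) x y)
    (hcrit2 : ∀ x y, (u1 x y ^ 2 + u2 x y ^ 2) / 2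
        + κ * (pd1 u1 x y + pd2 u2 x y) + η x y
        + Φ (q x y) - q x y * deriv Φ (q x y) = 0) :
    (∀ x y, v1 x y * pd1 u1 x y + v2 x y * pd2 u1 x y
        + u1 x y * pd1 v1 x y + u2 x y * pd1 v2 x y = pd1 B x y) ∧
    (∀ x y, v1 x y * pd1 u2 x y + v2 x y * pd2 u2 x y
        + u1 x y * pd2 v1 x y + u2 x y * pd2 v2 x y = pd2 B x y) ∧
    (∀ x y, pd1 (fun x y => η x y * v1 x y) x y
        + pd2 (fun x y => η x y * v2 x y) x y = 0) := by
  have hη0 : ∀ x y, η x y ≠ 0 := fun x y => (hηpos x y).ne'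
  have hlog : ContDiff ℝ ∞ (fun p : ℝ × ℝ => Real.log (η p.1 p.2)) :=
    hη.log fun p => hη0 p.1 p.2
  have hqs : ContDiff ℝ ∞ (fun p : ℝ × ℝ => q p.1 p.2) := by
    rw [hq]
    exact ((contDiff_pd1 hu2).sub (contDiff_pd2 hu1)).div hη fun p => hη0 p.1 p.2
  have hv1s : ContDiff ℝ ∞ (fun p : ℝ × ℝ => v1 p.1 p.2) := by
    rw [hv1]
    exact hu1.sub (contDiff_const.mul (contDiff_pd1 (f := fun x y => Real.log (η x y)) hlog))
  have hv2s : ContDiff ℝ ∞ (fun p : ℝ × ℝ => v2 p.1 p.2) := by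
    rw [hv2]
    exact hu2.sub (contDiff_const.mul (contDiff_pd2 (f := fun x y => Real.log (η x y)) hlog))
  have du1 := hu1.differentiable (by simp)
  have du2 := hu2.differentiable (by simp)
  have dη := hη.differentiable (by simp)
  have dq := hqs.differentiable (by simp)
  have dv1 := hv1s.differentiable (by simp)
  have dv2 := hv2s.differentiable (by simp)
  have hω : ∀ x y, pd1 u2 x y - pd2 u1 x y = q x y * η x y := fun x y => by
    rw [hq]
    exact (div_mul_cancel₀ _ (hη0 x y)).symm
  have hB' : ∀ x y, B x y = u1 x y * v1 x y + u2 x y * v2 x y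
      + (Φ (q x y) - q x y * deriv Φ (q x y)) := by
    intro x y
    have e1 : pd1 (fun x y => η x y * u1 x y) x y = _ :=
      ((hasDerivAt_pd1 dη x y).mul (hasDerivAt_pd1 du1 x y)).deriv
    have e2 : pd2 (fun x y => η x y * u2 x y) x y = _ :=
      ((hasDerivAt_pd2 dη x y).mul (hasDerivAt_pd2 du2 x y)).deriv
    have l1 : pd1 (fun x y => Real.log (η x y)) x y = _ :=
      ((hasDerivAt_pd1 dη x y).log (hη0 x y)).deriv
    have l2 : pd2 (fun x y => Real.log (η x y)) x y = _ :=
      ((hasDerivAt_pd2 dη x y).log (hη0 x y)).deriv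
    have hc := hcrit2 x y
    simp only [hB, hv1, hv2, e1, e2, l1, l2]
    have hne := hη0 x y
    rw [show Φ (q x y) - q x y * deriv Φ (q x y) = -((u1 x y ^ 2 + u2 x y ^ 2) / 2
      + κ * (pd1 u1 x y + pd2 u2 x y) + η x y) by linarith]
    field_simp
    ring
  refine ⟨fun x y => ?_, fun x y => ?_, fun x y => ?_⟩
  · have hd := (((hasDerivAt_pd1 du1 x y).mul (hasDerivAt_pd1 dv1 x y)).add
      ((hasDerivAt_pd1 du2 x y).mul (hasDerivAt_pd1 dv2 x y))).add
      (hasDerivAt_sub_mul_deriv_comp hΦ (hasDerivAt_pd1 dq x y))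
    have hBd : pd1 B x y = _ := (hd.congr_of_eventuallyEq (.of_forall fun s => hB' s y)).deriv
    have hc : η x y * v2 x y = deriv (fun s => deriv Φ (q s y)) x := hcrit1b x y
    rw [hBd, ← hc]
    linear_combination (-v2 x y) * hω x y
  · have hd := (((hasDerivAt_pd2 du1 x y).mul (hasDerivAt_pd2 dv1 x y)).add
      ((hasDerivAt_pd2 du2 x y).mul (hasDerivAt_pd2 dv2 x y))).add
      (hasDerivAt_sub_mul_deriv_comp hΦ (hasDerivAt_pd2 dq x y))
    have hBd : pd2 B x y = _ := (hd.congr_of_eventuallyEq (.of_forall fun s => hB' x s)).deriv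
    have hc : η x y * v1 x y = -deriv (fun s => deriv Φ (q x s)) y := hcrit1a x y
    rw [hBd, ← neg_eq_iff_eq_neg.2 hc]
    linear_combination v1 x y * hω x y
  · have hΦ' : ContDiff ℝ 1 (deriv Φ) := ((contDiff_succ_iff_deriv (n := 1)).1 hΦ).2.2
    have p1 : pd1 (fun x y => deriv Φ (q x y)) = fun x y => η x y * v2 x y :=
      funext₂ fun x y => (hcrit1b x y).symm
    have p2 : pd2 (fun x y => deriv Φ (q x y)) = fun x y => -(η x y * v1 x y) :=
      funext₂ fun x y => by rw [hcrit1a x y, neg_neg]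
    have hcomm := pd1_pd2_comm (f := fun x y => deriv Φ (q x y))
      ((hΦ'.differentiable one_ne_zero).comp dq)
      (by rw [p1]; exact dη.mul dv2) (by rw [p2]; exact (dη.mul dv1).neg) x y
    rw [p1, p2] at hcomm
    have hneg : pd1 (fun x y => -(η x y * v1 x y)) x y
        = -pd1 (fun x y => η x y * v1 x y) x y := deriv.fun_neg
    linarith
end
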